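/- Let p ∈ (−1, 1) and let a_1, a_2, a_3, a_4, b_1, b_2, b_3, b_4 > 0 satisfy a_1+a_2+a_3+a_4 ≤ b_1+b_2+b_3+b_4; a_1a_2+a_1a_3+a_2a_3+a_1a_4+a_2a_4+a_3a_4 ≤ b_1b_2+b_1b_3+b_2b_3+b_1b_4+b_2b_4+b_3b_4; a_1a_2a_3+a_1a_2a_4+a_2a_3a_4+a_1a_3a_4 ≤ b_1b_2b_3+b_1b_2b_4+b_2b_3b_4+b_1b_3b_4; and a_1a_2a_3a_4 = b_1b_2b_3b_4. Then a_1^p + a_2^p + a_3^p + a_4^p ≤ b_1^p + b_2^p + b_3^p + b_4^p. -/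

import Mathlib

open MeasureTheory Set in
/-- For `0 < p < 1` the kernel `t ^ (-p - 1) * log (1 + t)` is integrable on the positive
half-line. -/
theorem integrableOn_rpow_mul_log_one_add {p : ℝ} (hp0 : 0 < p) (hp1 : p < 1) :
    IntegrableOn (fun t : ℝ => t ^ (-p - 1) * Real.log (1 + t)) (Ioi 0) := by
  have hmeas : Measurable (fun t : ℝ => t ^ (-p - 1) * Real.log (1 + t)) := by fun_prop
  have hnorm : ∀ t : ℝ, 0 < t →
      ‖t ^ (-p - 1) * Real.log (1 + t)‖ = t ^ (-p - 1) * Real.log (1 + t) := fun t ht =>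
    Real.norm_of_nonneg (mul_nonneg (by positivity) (Real.log_nonneg (by linarith)))
  rw [← Ioc_union_Ioi_eq_Ioi (zero_le_one' ℝ)]
  refine IntegrableOn.union ?_ ?_
  · have h : IntegrableOn (fun t : ℝ => t ^ (-p)) (Ioc 0 1) :=
      (intervalIntegrable_iff_integrableOn_Ioc_of_le zero_le_one).1
        (intervalIntegral.intervalIntegrable_rpow' (by linarith))
    refine Integrable.mono' h hmeas.aestronglyMeasurable
      (ae_restrict_of_forall_mem measurableSet_Ioc fun t ht => ?_)
    have hlog : Real.log (1 + t) ≤ t := by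
      have := Real.log_le_sub_one_of_pos (show 0 < 1 + t by linarith [ht.1])
      linarith
    rw [hnorm t ht.1]
    calc t ^ (-p - 1) * Real.log (1 + t) ≤ t ^ (-p - 1) * t := by
          have := ht.1
          gcongr
      _ = t ^ (-p) := by
          rw [← Real.rpow_add_one ht.1.ne']
          ring_nf
  · have h : IntegrableOn (fun t : ℝ => (2 ^ (p / 2) / (p / 2)) * t ^ (-p / 2 - 1)) (Ioi 1) :=
      (integrableOn_Ioi_rpow_of_lt (by linarith) one_pos).const_mul _
    refine Integrable.mono' h hmeas.aestronglyMeasurable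
      (ae_restrict_of_forall_mem measurableSet_Ioi fun t ht => ?_)
    have ht1 : 1 < t := ht
    have ht0 : 0 < t := by linarith
    have hlog : Real.log (1 + t) ≤ 2 ^ (p / 2) * t ^ (p / 2) / (p / 2) := by
      rw [← Real.mul_rpow zero_le_two ht0.le]
      exact (Real.log_le_log (by linarith) (by linarith)).trans
        (Real.log_le_rpow_div (by positivity) (by linarith))
    rw [hnorm t ht0]
    calc t ^ (-p - 1) * Real.log (1 + t)
        ≤ t ^ (-p - 1) * (2 ^ (p / 2) * t ^ (p / 2) / (p / 2)) := by gcongr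
      _ = (2 ^ (p / 2) / (p / 2)) * (t ^ (-p - 1) * t ^ (p / 2)) := by ring
      _ = (2 ^ (p / 2) / (p / 2)) * t ^ (-p / 2 - 1) := by
          rw [← Real.rpow_add ht0]
          ring_nf

open MeasureTheory Set in
theorem integral_rpow_mul_log_one_add_pos {p : ℝ} (hp0 : 0 < p) (hp1 : p < 1) :
    0 < ∫ t in Ioi (0 : ℝ), t ^ (-p - 1) * Real.log (1 + t) := by
  have hpos : ∀ t ∈ Ioi (0 : ℝ), 0 < t ^ (-p - 1) * Real.log (1 + t) := fun t ht =>
    mul_pos (Real.rpow_pos_of_pos ht _) (Real.log_pos (by linarith [mem_Ioi.1 ht]))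
  rw [setIntegral_pos_iff_support_of_nonneg_ae
    (ae_restrict_of_forall_mem measurableSet_Ioi fun t ht => (hpos t ht).le)
    (integrableOn_rpow_mul_log_one_add hp0 hp1),
    inter_eq_self_of_subset_right fun t ht => Function.mem_support.2 (hpos t ht).ne']
  simp

theorem rpow_mul_log_one_add_mul {p a t : ℝ} (ha : 0 < a) (ht : 0 < t) :
    t ^ (-p - 1) * Real.log (1 + a * t) =
      a ^ (p + 1) * ((a * t) ^ (-p - 1) * Real.log (1 + a * t)) := by
  have h : a ^ (p + 1) * a ^ (-p - 1) = 1 := by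
    rw [← Real.rpow_add ha]
    simp
  rw [Real.mul_rpow ha.le ht.le]
  linear_combination -(t ^ (-p - 1) * Real.log (1 + a * t)) * h

open MeasureTheory Set in
theorem integrableOn_rpow_mul_log_one_add_mul {p a : ℝ} (hp0 : 0 < p) (hp1 : p < 1)
    (ha : 0 < a) :
    IntegrableOn (fun t : ℝ => t ^ (-p - 1) * Real.log (1 + a * t)) (Ioi 0) := by
  have h := (integrableOn_Ioi_comp_mul_left_iff
    (fun t : ℝ => t ^ (-p - 1) * Real.log (1 + t)) 0 ha).2
    (by simpa using integrableOn_rpow_mul_log_one_add hp0 hp1)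
  exact IntegrableOn.congr_fun (h.const_mul (a ^ (p + 1)))
    (fun t ht => (rpow_mul_log_one_add_mul ha ht).symm) measurableSet_Ioi

open MeasureTheory Set in
/-- The integral representation of `a ^ p` by logarithms, up to a constant. -/
theorem integral_rpow_mul_log_one_add_mul {p a : ℝ} (ha : 0 < a) :
    ∫ t in Ioi (0 : ℝ), t ^ (-p - 1) * Real.log (1 + a * t) =
      a ^ p * ∫ t in Ioi (0 : ℝ), t ^ (-p - 1) * Real.log (1 + t) := by
  rw [setIntegral_congr_fun measurableSet_Ioi fun t ht => rpow_mul_log_one_add_mul ha ht,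
    integral_const_mul,
    integral_comp_mul_left_Ioi (fun t : ℝ => t ^ (-p - 1) * Real.log (1 + t)) 0 ha,
    Real.rpow_add_one ha.ne']
  simp only [mul_zero, smul_eq_mul]
  field_simp

open MeasureTheory Set in
/-- If `∏ (1 + a i * t) ≤ ∏ (1 + b i * t)` for all `t > 0`, then `∑ a i ^ p ≤ ∑ b i ^ p`
for `0 < p < 1`. -/
theorem sum_rpow_le_sum_rpow_of_prod_one_add_mul_le {ι : Type*} (s : Finset ι) {p : ℝ}
    (hp0 : 0 < p) (hp1 : p < 1) {a b : ι → ℝ} (ha : ∀ i, 0 < a i) (hb : ∀ i, 0 < b i)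
    (h : ∀ t : ℝ, 0 < t → ∏ i ∈ s, (1 + a i * t) ≤ ∏ i ∈ s, (1 + b i * t)) :
    ∑ i ∈ s, a i ^ p ≤ ∑ i ∈ s, b i ^ p := by
  refine le_of_mul_le_mul_right ?_ (integral_rpow_mul_log_one_add_pos hp0 hp1)
  simp only [Finset.sum_mul]
  simp_rw [← integral_rpow_mul_log_one_add_mul (ha _), ← integral_rpow_mul_log_one_add_mul (hb _)]
  rw [← integral_finsetSum _ fun i _ => integrableOn_rpow_mul_log_one_add_mul hp0 hp1 (ha i),
    ← integral_finsetSum _ fun i _ => integrableOn_rpow_mul_log_one_add_mul hp0 hp1 (hb i)]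
  refine setIntegral_mono_on
    (integrable_finsetSum _ fun i _ => integrableOn_rpow_mul_log_one_add_mul hp0 hp1 (ha i))
    (integrable_finsetSum _ fun i _ => integrableOn_rpow_mul_log_one_add_mul hp0 hp1 (hb i))
    measurableSet_Ioi fun t ht => ?_
  have ht0 : 0 < t := ht
  have hposa : ∀ i, 0 < 1 + a i * t := fun i => by have := ha i; positivity
  have hposb : ∀ i, 0 < 1 + b i * t := fun i => by have := hb i; positivity
  rw [← Finset.mul_sum, ← Finset.mul_sum, ← Real.log_prod fun i _ => (hposa i).ne',
    ← Real.log_prod fun i _ => (hposb i).ne']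
  exact mul_le_mul_of_nonneg_left
    (Real.log_le_log (Finset.prod_pos fun i _ => hposa i) (h t ht0)) (by positivity)

/-- The case `0 < p < 1`, where an inequality between the products is enough. -/
theorem sum_of_powers_four_of_pos
    {p : ℝ} (hp0 : 0 < p) (hp1 : p < 1)
    {a₁ a₂ a₃ a₄ b₁ b₂ b₃ b₄ : ℝ}
    (ha₁ : 0 < a₁) (ha₂ : 0 < a₂) (ha₃ : 0 < a₃) (ha₄ : 0 < a₄)
    (hb₁ : 0 < b₁) (hb₂ : 0 < b₂) (hb₃ : 0 < b₃) (hb₄ : 0 < b₄)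
    (h1 : a₁ + a₂ + a₃ + a₄ ≤ b₁ + b₂ + b₃ + b₄)
    (h2 : a₁ * a₂ + a₁ * a₃ + a₂ * a₃ + a₁ * a₄ + a₂ * a₄ + a₃ * a₄ ≤
          b₁ * b₂ + b₁ * b₃ + b₂ * b₃ + b₁ * b₄ + b₂ * b₄ + b₃ * b₄)
    (h3 : a₁ * a₂ * a₃ + a₁ * a₂ * a₄ + a₂ * a₃ * a₄ + a₁ * a₃ * a₄ ≤
          b₁ * b₂ * b₃ + b₁ * b₂ * b₄ + b₂ * b₃ * b₄ + b₁ * b₃ * b₄)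
    (h4 : a₁ * a₂ * a₃ * a₄ ≤ b₁ * b₂ * b₃ * b₄) :
    a₁ ^ p + a₂ ^ p + a₃ ^ p + a₄ ^ p ≤ b₁ ^ p + b₂ ^ p + b₃ ^ p + b₄ ^ p := by
  have key := sum_rpow_le_sum_rpow_of_prod_one_add_mul_le Finset.univ hp0 hp1
    (a := ![a₁, a₂, a₃, a₄]) (b := ![b₁, b₂, b₃, b₄])
    (by simp [Fin.forall_fin_succ, *]) (by simp [Fin.forall_fin_succ, *]) ?_
  · simpa [Fin.sum_univ_four] using key
  · intro t ht
    simp only [Fin.prod_univ_four, Matrix.cons_val]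
    have e1 := mul_le_mul_of_nonneg_right h1 ht.le
    have e2 := mul_le_mul_of_nonneg_right h2 (pow_pos ht 2).le
    have e3 := mul_le_mul_of_nonneg_right h3 (pow_pos ht 3).le
    have e4 := mul_le_mul_of_nonneg_right h4 (pow_pos ht 4).le
    linear_combination e1 + e2 + e3 + e4


theorem sum_of_powers_four
    (p : ℝ) (hp : p ∈ Set.Ioo (-1 : ℝ) 1)
    (a₁ a₂ a₃ a₄ b₁ b₂ b₃ b₄ : ℝ)
    (ha₁ : 0 < a₁) (ha₂ : 0 < a₂) (ha₃ : 0 < a₃) (ha₄ : 0 < a₄)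
    (hb₁ : 0 < b₁) (hb₂ : 0 < b₂) (hb₃ : 0 < b₃) (hb₄ : 0 < b₄)
    (h1 : a₁ + a₂ + a₃ + a₄ ≤ b₁ + b₂ + b₃ + b₄)
    (h2 : a₁ * a₂ + a₁ * a₃ + a₂ * a₃ + a₁ * a₄ + a₂ * a₄ + a₃ * a₄ ≤
          b₁ * b₂ + b₁ * b₃ + b₂ * b₃ + b₁ * b₄ + b₂ * b₄ + b₃ * b₄)
    (h3 : a₁ * a₂ * a₃ + a₁ * a₂ * a₄ + a₂ * a₃ * a₄ + a₁ * a₃ * a₄ ≤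
          b₁ * b₂ * b₃ + b₁ * b₂ * b₄ + b₂ * b₃ * b₄ + b₁ * b₃ * b₄)
    (h4 : a₁ * a₂ * a₃ * a₄ = b₁ * b₂ * b₃ * b₄) :
    a₁ ^ p + a₂ ^ p + a₃ ^ p + a₄ ^ p ≤ b₁ ^ p + b₂ ^ p + b₃ ^ p + b₄ ^ p := by
  rcases lt_trichotomy p 0 with hp0 | rfl | hp0
  · have hinv : ∀ x : ℝ, 0 < x → x ^ p = x⁻¹ ^ (-p) := fun x hx => by
      rw [Real.inv_rpow hx.le, Real.rpow_neg hx.le, inv_inv]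
    have hP : 0 < b₁ * b₂ * b₃ * b₄ := by positivity
    have hdiv : ∀ {x y : ℝ}, x ≤ y →
        x / (a₁ * a₂ * a₃ * a₄) ≤ y / (b₁ * b₂ * b₃ * b₄) := fun hxy => by
      rw [h4]
      gcongr
    rw [hinv a₁ ha₁, hinv a₂ ha₂, hinv a₃ ha₃, hinv a₄ ha₄,
      hinv b₁ hb₁, hinv b₂ hb₂, hinv b₃ hb₃, hinv b₄ hb₄]
    apply sum_of_powers_four_of_pos (by linarith) (by linarith [hp.1]) <;> try positivity
    · convert hdiv h3 using 1 <;> field_simp <;> ring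
    · convert hdiv h2 using 1 <;> field_simp <;> ring
    · convert hdiv h1 using 1 <;> field_simp <;> ring
    · convert hdiv (le_refl 1) using 1 <;> field_simp
  · simp
  · exact sum_of_powers_four_of_pos hp0 hp.2 ha₁ ha₂ ha₃ ha₄ hb₁ hb₂ hb₃ hb₄ h1 h2 h3 h4.le
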